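/- arXiv:1907.09751 — 5 statements merged into one kernel-verified Lean document; each statement's English description precedes it below -/
import Mathlib

section
/- For every n ≥ 1, the root lattice A_n = {x ∈ ℤ^{n+1} : x₀ + x₁ + ⋯ + x_n = 0}, viewed as a lattice in ℝ^{n+1}, has chromatic number χ(A_n) = n + 1. -/
open scoped RealInnerProductSpace

noncomputable section

/-- The set of strict Voronoi vectors of a lattice, given as a subset of `ℝⁿ`:
those nonzero `u` in the lattice such that `±u` are the unique shortest vectors
in the coset `u + 2Λ`. -/
def vorS {N : ℕ} (Λ : Set (EuclideanSpace ℝ (Fin N))) : Set (EuclideanSpace ℝ (Fin N)) :=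
  {u | u ∈ Λ ∧ u ≠ 0 ∧
    ∀ v ∈ Λ, u + (2 : ℝ) • v ≠ u → u + (2 : ℝ) • v ≠ -u → ‖u‖ < ‖u + (2 : ℝ) • v‖}

/-- The Cayley graph of a lattice with its strict Voronoi vectors as generating set:
distinct lattice points are adjacent iff their difference is a strict Voronoi vector. -/
def cayleyS {N : ℕ} (Λ : Set (EuclideanSpace ℝ (Fin N))) : SimpleGraph Λ :=
  SimpleGraph.fromRel (fun v w => ((v : EuclideanSpace ℝ (Fin N)) - w) ∈ vorS Λ)

/-- The chromatic number of a lattice. -/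
def latChromS {N : ℕ} (Λ : Set (EuclideanSpace ℝ (Fin N))) : ℕ∞ :=
  (cayleyS Λ).chromaticNumber

/-- The root lattice `Aₙ`, as the set of integer vectors in `ℝ^{n+1}` whose
coordinates sum to zero. -/
def latticeA (n : ℕ) : Set (EuclideanSpace ℝ (Fin (n + 1))) :=
  {x | (∀ i, ∃ m : ℤ, x i = (m : ℝ)) ∧ ∑ i, x i = 0}

/-- The root `eᵢ - eⱼ`. -/
def rootA (n : ℕ) (i j : Fin (n + 1)) : EuclideanSpace ℝ (Fin (n + 1)) :=
  EuclideanSpace.single i 1 - EuclideanSpace.single j 1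

theorem rootA_apply (n : ℕ) (i j k : Fin (n + 1)) :
    rootA n i j k = (if k = i then 1 else 0) - (if k = j then 1 else 0) := by
  simp [rootA]

theorem rootA_mem (n : ℕ) (i j : Fin (n + 1)) : rootA n i j ∈ latticeA n := by
  refine ⟨fun k => ⟨(if k = i then 1 else 0) - (if k = j then 1 else 0), ?_⟩, ?_⟩
  · rw [rootA_apply]
    push_cast
    rfl
  · simp [rootA_apply, Finset.sum_sub_distrib]

theorem neg_rootA (n : ℕ) (i j : Fin (n + 1)) : -rootA n i j = rootA n j i := by
  simp [rootA]

theorem inner_rootA (n : ℕ) (i j : Fin (n + 1)) (u : EuclideanSpace ℝ (Fin (n + 1))) :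
    inner ℝ u (rootA n i j) = u i - u j := by
  simp [rootA, inner_sub_right, EuclideanSpace.inner_single_right]

theorem norm_sq_rootA (n : ℕ) {i j : Fin (n + 1)} (hij : i ≠ j) :
    ‖rootA n i j‖ ^ 2 = 2 := by
  rw [← real_inner_self_eq_norm_sq, inner_rootA, rootA_apply, rootA_apply]
  norm_num [hij, hij.symm]

/-- Every strict Voronoi vector of `Aₙ` is a root. -/
theorem eq_rootA_of_mem_vorS {n : ℕ} {u : EuclideanSpace ℝ (Fin (n + 1))}
    (hu : u ∈ vorS (latticeA n)) : ∃ i j, i ≠ j ∧ u = rootA n i j := by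
  obtain ⟨⟨hint, hsum⟩, hne, hmin⟩ := hu
  have hex : ∃ k ∈ Finset.univ, u k ≠ 0 := by
    by_contra! h
    exact hne (by ext k; simpa using h k (Finset.mem_univ k))
  obtain ⟨i, -, hi⟩ := Finset.exists_pos_of_sum_zero_of_exists_nonzero u hsum hex
  obtain ⟨j, -, hj⟩ : ∃ j ∈ Finset.univ, u j < 0 := by
    by_contra! h
    exact hi.ne' ((Finset.sum_eq_zero_iff_of_nonneg h).1 hsum i (Finset.mem_univ i))
  have hij : i ≠ j := by
    rintro rfl
    linarith
  have hi1 : 1 ≤ u i := by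
    obtain ⟨m, hm⟩ := hint i
    rw [hm] at hi ⊢
    have hpos : 0 < m := by exact_mod_cast hi
    have hle : ((1 : ℤ) : ℝ) ≤ m := Int.cast_le.2 hpos
    simpa using hle
  have hj1 : u j ≤ -1 := by
    obtain ⟨m, hm⟩ := hint j
    rw [hm] at hj ⊢
    have hneg : m < 0 := Int.cast_lt_zero.1 hj
    have hle : (m : ℝ) ≤ ((-1 : ℤ) : ℝ) := Int.cast_le.2 (by omega)
    simpa using hle
  refine ⟨i, j, hij, ?_⟩
  by_contra hroot
  have hlt := hmin (rootA n j i) (rootA_mem n j i) ?_ ?_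
  · have hsq := pow_lt_pow_left₀ hlt (norm_nonneg _) two_ne_zero
    rw [norm_add_sq_real, real_inner_smul_right, inner_rootA, norm_smul, mul_pow,
      norm_sq_rootA n hij.symm] at hsq
    norm_num at hsq
    linarith
  · intro h
    have h0 : rootA n j i = 0 := by simpa using h
    have := norm_sq_rootA n hij.symm
    simp [h0] at this
  · intro h
    rw [← neg_rootA, smul_neg] at h
    have h2 : (2 : ℝ) • u = (2 : ℝ) • rootA n i j := by
      rw [two_smul ℝ u]
      linear_combination (norm := module) h
    exact hroot (smul_right_injective _ (two_ne_zero' ℝ) h2)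

/-- Every root of `Aₙ` is a strict Voronoi vector. -/
theorem rootA_mem_vorS (n : ℕ) {i j : Fin (n + 1)} (hij : i ≠ j) :
    rootA n i j ∈ vorS (latticeA n) := by
  refine ⟨rootA_mem n i j, ?_, ?_⟩
  · intro h
    have := norm_sq_rootA n hij
    simp [h] at this
  rintro v ⟨hint, hsum⟩ hne hneg
  choose m hm using hint
  set c : Fin (n + 1) → ℤ :=
    fun k => (if k = i then 1 else 0) - (if k = j then 1 else 0) + 2 * m k with hc
  have hw : ∀ k, (rootA n i j + (2 : ℝ) • v) k = c k := by
    intro k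
    simp [rootA_apply, hm, hc]
  have hci : c i = 1 + 2 * m i := by simp [hc, hij]
  have hcj : c j = -1 + 2 * m j := by simp [hc, hij.symm]
  have hc0 : ∑ k, c k = 0 := by
    have hm0 : ∑ k, m k = 0 := by
      simp only [hm] at hsum
      exact_mod_cast hsum
    simp [hc, Finset.sum_add_distrib, Finset.sum_sub_distrib, ← Finset.mul_sum, hm0]
  refine lt_of_pow_lt_pow_left₀ 2 (norm_nonneg _) ?_
  rw [norm_sq_rootA n hij, EuclideanSpace.real_norm_sq_eq]
  simp only [hw]
  by_contra! hle
  have hle' : ∑ k, c k ^ 2 ≤ 2 := by exact_mod_cast hle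
  have hsplit : ∀ f : Fin (n + 1) → ℤ,
      ∑ k, f k = f i + f j + ∑ k ∈ (Finset.univ.erase i).erase j, f k := by
    intro f
    rw [← Finset.add_sum_erase _ _ (Finset.mem_univ i),
      ← Finset.add_sum_erase _ _ (Finset.mem_erase.2 ⟨hij.symm, Finset.mem_univ j⟩), add_assoc]
  have hi1 : 1 ≤ c i ^ 2 := by
    have : c i ≠ 0 := by omega
    have := sq_pos_iff.2 this
    omega
  have hj1 : 1 ≤ c j ^ 2 := by
    have : c j ≠ 0 := by omega
    have := sq_pos_iff.2 this
    omega
  have hrest := Finset.sum_nonneg (s := (Finset.univ.erase i).erase j)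
    (fun k _ => sq_nonneg (c k))
  rw [hsplit] at hle' hc0
  have hzero : ∀ k ∈ (Finset.univ.erase i).erase j, c k = 0 := by
    intro k hk
    have := (Finset.sum_eq_zero_iff_of_nonneg (fun k _ => sq_nonneg (c k))).1
      (by linarith : ∑ k ∈ (Finset.univ.erase i).erase j, c k ^ 2 = 0) k hk
    exact pow_eq_zero_iff two_ne_zero |>.1 this
  rw [Finset.sum_eq_zero hzero, add_zero] at hc0
  have hother : ∀ k, k ≠ i → k ≠ j → c k = 0 := fun k hki hkj => hzero k (by simp [hki, hkj])
  have hcj' : c j = -c i := by linarith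
  have hci2 : c i ^ 2 = 1 := by linarith
  rcases eq_or_eq_neg_of_sq_eq_sq (c i) 1 (by rw [hci2, one_pow]) with h | h
  · refine hne ?_
    ext k
    rw [hw, rootA_apply]
    by_cases hki : k = i
    · subst hki; simp [h, hij]
    by_cases hkj : k = j
    · subst hkj; simp [h, hcj', hki]
    · simp [hother k hki hkj, hki, hkj]
  · refine hneg ?_
    ext k
    rw [hw, neg_rootA, rootA_apply]
    by_cases hki : k = i
    · subst hki; simp [h, hij]
    by_cases hkj : k = j
    · subst hkj; simp [h, hcj', hki]
    · simp [hother k hki hkj, hki, hkj]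

/-- The residue of `∑ k xₖ` modulo `n + 1`, a proper colouring of the Cayley graph of `Aₙ`. -/
def colorA (n : ℕ) (x : EuclideanSpace ℝ (Fin (n + 1))) : ZMod (n + 1) :=
  ∑ k : Fin (n + 1), (k.val : ZMod (n + 1)) * (⌊x k⌋ : ℤ)

theorem colorA_ne_of_sub_mem_vorS {n : ℕ} {v w : EuclideanSpace ℝ (Fin (n + 1))}
    (h : v - w ∈ vorS (latticeA n)) : colorA n v ≠ colorA n w := by
  obtain ⟨i, j, hij, hr⟩ := eq_rootA_of_mem_vorS h
  have hfloor : ∀ k, ⌊v k⌋ = ⌊w k⌋ + ((if k = i then 1 else 0) - (if k = j then 1 else 0)) := by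
    intro k
    have hk : v k = w k + (((if k = i then 1 else 0) - (if k = j then 1 else 0) : ℤ) : ℝ) := by
      have := congrArg (fun x : EuclideanSpace ℝ (Fin (n + 1)) => x k) hr
      simp only [PiLp.sub_apply, rootA_apply] at this
      push_cast
      linarith
    rw [hk, Int.floor_add_intCast]
  have hcol : colorA n v = colorA n w + ((i.val : ZMod (n + 1)) - j.val) := by
    simp [colorA, hfloor, mul_add, mul_sub, Finset.sum_add_distrib, Finset.sum_sub_distrib]
  intro heq
  rw [hcol, add_eq_left, sub_eq_zero, ZMod.natCast_eq_natCast_iff'] at heq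
  rw [Nat.mod_eq_of_lt i.isLt, Nat.mod_eq_of_lt j.isLt] at heq
  exact hij (Fin.ext heq)

theorem colorable_latticeA (n : ℕ) : (cayleyS (latticeA n)).Colorable (n + 1) := by
  have C : (cayleyS (latticeA n)).Coloring (ZMod (n + 1)) :=
    SimpleGraph.Coloring.mk (fun x => colorA n x) (by
      rintro v w ⟨-, h | h⟩
      · exact colorA_ne_of_sub_mem_vorS h
      · exact (colorA_ne_of_sub_mem_vorS h).symm)
  simpa [ZMod.card] using C.colorable

theorem exists_clique_latticeA (n : ℕ) :
    ∃ f : Fin (n + 1) → latticeA n, Pairwise fun i j => (cayleyS (latticeA n)).Adj (f i) (f j) := by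
  refine ⟨fun i => ⟨rootA n i 0, rootA_mem n i 0⟩, fun i j hij => ?_⟩
  have hmem : rootA n i 0 - rootA n j 0 ∈ vorS (latticeA n) := by
    have : rootA n i 0 - rootA n j 0 = rootA n i j := by simp [rootA]
    exact this ▸ rootA_mem_vorS n hij
  refine ⟨fun h => hmem.2.1 (sub_eq_zero.2 (congrArg Subtype.val h)), Or.inl hmem⟩

/-- The chromatic number of the root lattice `Aₙ` is `n + 1`. -/
theorem chromatic_latticeA (n : ℕ) (hn : 1 ≤ n) :
    latChromS (latticeA n) = (n + 1 : ℕ∞) := by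
  refine le_antisymm (by exact_mod_cast (colorable_latticeA n).chromaticNumber_le) ?_
  obtain ⟨f, hf⟩ := exists_clique_latticeA n
  refine SimpleGraph.le_chromaticNumber_iff_coloring.2 fun m C => ?_
  have hinj : Function.Injective fun i => C (f i) := fun i j hij => by
    by_contra hne
    exact C.valid (hf hne) hij
  simpa using Fintype.card_le_of_injective _ hinj
end
end

section
/- For every n ≥ 1, the dual lattice A_n* = {x ∈ ℝ^{n+1} : x₀ + x₁ + ⋯ + x_n = 0 and x · y ∈ ℤ for all y ∈ A_n}, where A_n = {y ∈ ℤ^{n+1} : y₀ + ⋯ + y_n = 0}, has chromatic number χ(A_n*) = n + 1. -/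
open scoped RealInnerProductSpace

noncomputable section

/-- The dual lattice `Aₙ*`: the vectors of the hyperplane `x₀ + ⋯ + xₙ = 0` having
integer inner product with every element of `Aₙ`. -/
def latticeAdual (n : ℕ) : Set (EuclideanSpace ℝ (Fin (n + 1))) :=
  {x | ∑ i, x i = 0 ∧ ∀ y ∈ latticeA n, ∃ m : ℤ, ⟪x, y⟫ = (m : ℝ)}

lemma euclidean_inner_eq_sum {N : ℕ} (x y : EuclideanSpace ℝ (Fin N)) :
    ⟪x, y⟫ = ∑ i, x i * y i := by
  simp [PiLp.inner_apply, mul_comm]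

lemma mem_latticeAdual_iff {n : ℕ} {x : EuclideanSpace ℝ (Fin (n + 1))} :
    x ∈ latticeAdual n ↔ ∑ i, x i = 0 ∧ ∀ i j, ∃ m : ℤ, x i - x j = m := by
  refine and_congr_right fun hx => ⟨fun h i j => ?_, fun h y hy => ?_⟩
  · obtain ⟨m, hm⟩ := h (EuclideanSpace.single i 1 - EuclideanSpace.single j 1)
      ⟨fun k => ⟨(if k = i then 1 else 0) - (if k = j then 1 else 0), by
        simp⟩, by simp⟩
    refine ⟨m, ?_⟩
    rw [← hm, inner_sub_right]
    simp [EuclideanSpace.inner_single_right]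
  · choose k hk using hy.1
    choose d hd using fun i => h i 0
    refine ⟨∑ i, d i * k i, ?_⟩
    have h0 : ∑ i, x i * y i = ∑ i, (x i - x 0) * y i := by
      simp only [sub_mul, Finset.sum_sub_distrib, ← Finset.mul_sum, hy.2]
      simp
    rw [euclidean_inner_eq_sum, h0]
    push_cast
    exact Finset.sum_congr rfl fun i _ => by rw [hd, hk]

/-- The orthogonal projection of the indicator vector of `S` to the hyperplane of vectors whose
coordinates sum to zero. -/
def centeredIndicator {n : ℕ} (S : Finset (Fin (n + 1))) : EuclideanSpace ℝ (Fin (n + 1)) :=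
  WithLp.toLp 2 fun i => (if i ∈ S then 1 else 0) - (S.card : ℝ) / (n + 1)

lemma centeredIndicator_apply {n : ℕ} (S : Finset (Fin (n + 1))) (i : Fin (n + 1)) :
    centeredIndicator S i = (if i ∈ S then 1 else 0) - (S.card : ℝ) / (n + 1) := rfl

lemma centeredIndicator_mem {n : ℕ} (S : Finset (Fin (n + 1))) :
    centeredIndicator S ∈ latticeAdual n := by
  refine mem_latticeAdual_iff.2 ⟨?_, fun i j =>
    ⟨(if i ∈ S then 1 else 0) - (if j ∈ S then 1 else 0), ?_⟩⟩
  · have : (n + 1 : ℝ) ≠ 0 := by positivity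
    simp only [centeredIndicator_apply, Finset.sum_sub_distrib]
    simp
    field_simp
    ring
  · simp [centeredIndicator_apply]

lemma inner_centeredIndicator {n : ℕ} (S : Finset (Fin (n + 1)))
    {v : EuclideanSpace ℝ (Fin (n + 1))} (hv : ∑ i, v i = 0) :
    ⟪centeredIndicator S, v⟫ = ∑ i ∈ S, v i := by
  rw [euclidean_inner_eq_sum]
  simp only [centeredIndicator_apply, sub_mul, Finset.sum_sub_distrib, ← Finset.mul_sum, hv]
  simp

lemma norm_sq_centeredIndicator {n : ℕ} (S : Finset (Fin (n + 1))) :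
    ‖centeredIndicator S‖ ^ 2 = S.card - (S.card : ℝ) ^ 2 / (n + 1) := by
  rw [← real_inner_self_eq_norm_sq,
    inner_centeredIndicator S (mem_latticeAdual_iff.1 (centeredIndicator_mem S)).1,
    Finset.sum_congr rfl fun i hi => by rw [centeredIndicator_apply, if_pos hi]]
  simp
  ring

lemma norm_add_two_smul_sq {N : ℕ} (u v : EuclideanSpace ℝ (Fin N)) :
    ‖u + (2 : ℝ) • v‖ ^ 2 = ‖u‖ ^ 2 + 4 * (⟪u, v⟫ + ‖v‖ ^ 2) := by
  rw [norm_add_sq_real, inner_smul_right, norm_smul]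
  norm_num
  ring

lemma eq_zero_of_sum_eq_zero_of_const {n : ℕ} {w : EuclideanSpace ℝ (Fin (n + 1))}
    (hw : ∑ i, w i = 0) {c : ℝ} (h : ∀ i, w i = c) : w = 0 := by
  have hc : (n + 1 : ℝ) * c = 0 := by simpa [h] using hw
  have : (n + 1 : ℝ) ≠ 0 := by positivity
  ext i
  simpa [h, this] using hc

/-- A strict Voronoi vector of `Aₙ*` is not integral. -/
lemma vorS_apply_zero_ne_int {n : ℕ} {u : EuclideanSpace ℝ (Fin (n + 1))}
    (hu : u ∈ vorS (latticeAdual n)) (m : ℤ) : u 0 ≠ m := by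
  intro hm
  obtain ⟨huΛ, hu0, hmin⟩ := hu
  obtain ⟨hsum, hdiff⟩ := mem_latticeAdual_iff.1 huΛ
  have hZ (i) : ∃ k : ℤ, u i = k := by
    obtain ⟨d, hd⟩ := hdiff i 0
    exact ⟨d + m, by push_cast; linarith⟩
  let S : Finset (Fin (n + 1)) := {i | 0 < u i}
  have hS : S.Nonempty := by
    by_contra hS
    have hle : ∀ i ∈ Finset.univ, u i ≤ 0 := fun i hi => by
      by_contra h
      exact hS ⟨i, by simpa [S] using h⟩
    exact hu0 (by ext i; exact (Finset.sum_eq_zero_iff_of_nonpos hle).1 hsum i (Finset.mem_univ i))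
  have hcard : (S.card : ℝ) ≤ ∑ i ∈ S, u i := by
    rw [Finset.cast_card]
    refine Finset.sum_le_sum fun i hi => ?_
    obtain ⟨k, hk⟩ := hZ i
    have hpos : 0 < u i := by simpa [S] using hi
    rw [hk] at hpos ⊢
    exact_mod_cast Int.add_one_le_iff.2 (Int.cast_pos.1 hpos)
  have hlt : ‖u + (2 : ℝ) • -centeredIndicator S‖ < ‖u‖ := by
    refine lt_of_pow_lt_pow_left₀ 2 (norm_nonneg _) ?_
    rw [norm_add_two_smul_sq, norm_neg, inner_neg_right, real_inner_comm,
      inner_centeredIndicator S hsum, norm_sq_centeredIndicator]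
    have : (0 : ℝ) < S.card := by exact_mod_cast hS.card_pos
    have : 0 < (S.card : ℝ) ^ 2 / (n + 1) := by positivity
    linarith
  refine lt_asymm hlt (hmin _ ?_ (fun h => ?_) (fun h => ?_))
  · obtain ⟨h1, h2⟩ := mem_latticeAdual_iff.1 (centeredIndicator_mem S)
    refine mem_latticeAdual_iff.2 ⟨by simpa using h1, fun i j => ?_⟩
    obtain ⟨k, hk⟩ := h2 j i
    exact ⟨k, by rw [← hk]; simp only [PiLp.neg_apply]; ring⟩
  · exact hlt.ne (by rw [h])
  · exact hlt.ne (by rw [h, norm_neg])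

lemma sum_sum_sub_mul_sub {n : ℕ} (a b : Fin (n + 1) → ℝ) :
    ∑ i, ∑ j, (a i - a j) * (b i - b j) =
      2 * ((n + 1) * ∑ i, a i * b i - (∑ i, a i) * ∑ i, b i) := by
  have h (i j) : (a i - a j) * (b i - b j) = a i * b i - a i * b j - a j * b i + a j * b j := by
    ring
  simp only [h, Finset.sum_add_distrib, Finset.sum_sub_distrib, Finset.sum_const, Finset.card_univ,
    Fintype.card_fin, nsmul_eq_mul]
  simp only [← Finset.mul_sum, ← Finset.sum_mul]
  push_cast
  ring

lemma centeredIndicator_mem_vorS {n : ℕ} {S : Finset (Fin (n + 1))} {a b : Fin (n + 1)}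
    (ha : a ∈ S) (hb : b ∉ S) : centeredIndicator S ∈ vorS (latticeAdual n) := by
  refine ⟨centeredIndicator_mem S, fun h => ?_, fun v hv h0 hneg => ?_⟩
  · have h1 : centeredIndicator S a - centeredIndicator S b = 0 := by simp [h]
    simp [centeredIndicator_apply, ha, hb] at h1
  obtain ⟨hsum, hdiff⟩ := mem_latticeAdual_iff.1 hv
  obtain ⟨husum, -⟩ := mem_latticeAdual_iff.1 (centeredIndicator_mem S)
  set u := centeredIndicator S with hu
  have husub (i j) : u i - u j = (if i ∈ S then 1 else 0) - (if j ∈ S then 1 else 0) := by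
    simp [hu, centeredIndicator_apply]
  have hterm (i j) : 0 ≤ (u i + v i - (u j + v j)) * (v i - v j) := by
    obtain ⟨d, hd⟩ := hdiff i j
    have : (u i + v i - (u j + v j)) * (v i - v j) = ((u i - u j) + (v i - v j)) * (v i - v j) := by
      ring
    rw [this, husub, hd]
    have h1 : 0 ≤ (1 + d) * d := by
      rcases le_or_gt 0 d with h | h <;> nlinarith
    have h2 : 0 ≤ (-1 + d) * d := by
      rcases le_or_gt d 0 with h | h <;> nlinarith
    have h1' : (0 : ℝ) ≤ (1 + d) * d := by exact_mod_cast h1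
    have h2' : (0 : ℝ) ≤ (-1 + d) * d := by exact_mod_cast h2
    split_ifs <;> norm_num <;> first | assumption | exact mul_self_nonneg _
  have hid : ∑ i, ∑ j, (u i + v i - (u j + v j)) * (v i - v j) =
      2 * (n + 1) * (⟪u, v⟫ + ‖v‖ ^ 2) := by
    rw [sum_sum_sub_mul_sub (fun i => u i + v i) v, ← real_inner_self_eq_norm_sq,
      ← inner_add_left, euclidean_inner_eq_sum, hsum]
    simp
    ring
  refine lt_of_pow_lt_pow_left₀ 2 (norm_nonneg _) ?_
  rw [norm_add_two_smul_sq]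
  suffices 0 < ⟪u, v⟫ + ‖v‖ ^ 2 by linarith
  by_contra hle
  have hz : ∑ i, ∑ j, (u i + v i - (u j + v j)) * (v i - v j) = 0 := by
    refine le_antisymm ?_ (Finset.sum_nonneg fun i _ => Finset.sum_nonneg fun j _ => hterm i j)
    rw [hid]
    exact mul_nonpos_of_nonneg_of_nonpos (by positivity) (not_lt.1 hle)
  have hzero (i j) : (u i - u j) + (v i - v j) = 0 ∨ v i - v j = 0 := by
    have h1 := (Finset.sum_eq_zero_iff_of_nonneg
      (fun i _ => Finset.sum_nonneg fun j _ => hterm i j)).1 hz i (Finset.mem_univ i)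
    have h2 := (Finset.sum_eq_zero_iff_of_nonneg (fun j _ => hterm i j)).1 h1 j (Finset.mem_univ j)
    rcases mul_eq_zero.1 h2 with h | h
    · left; linarith
    · exact .inr h
  have hsame {i j} (hij : i ∈ S ↔ j ∈ S) : v i = v j := by
    have hs := husub i j
    simp only [hij, sub_self] at hs
    rcases hzero i j with h | h <;> linarith
  have hva (i) (hi : i ∈ S) : v i = v a := hsame (by simp [hi, ha])
  have hvb (i) (hi : i ∉ S) : v i = v b := hsame (by simp [hi, hb])
  rcases hzero a b with h | h
  · have hw : u + v = 0 := by
      refine eq_zero_of_sum_eq_zero_of_const (c := u a + v a)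
        (by simp [Finset.sum_add_distrib, husum, hsum]) fun i => ?_
      have hia := husub i a
      have hab := husub a b
      by_cases hi : i ∈ S
      · have := hva i hi
        simp only [hi, ha, if_true, sub_self] at hia
        simp only [PiLp.add_apply]
        linarith
      · have := hvb i hi
        simp only [hi, ha, hb, if_true, if_false] at hia hab
        simp only [PiLp.add_apply]
        linarith
    apply hneg
    rw [eq_neg_of_add_eq_zero_right hw]
    module
  · have hw : v = 0 := eq_zero_of_sum_eq_zero_of_const hsum (c := v a) fun i => by
      by_cases hi : i ∈ S
      · exact hva i hi
      · rw [hvb i hi]; linarith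
    exact h0 (by simp [hw])

lemma latticeAdual_colorable (n : ℕ) : (cayleyS (latticeAdual n)).Colorable (n + 1) := by
  have hZ (x : latticeAdual n) : ∃ m : ℤ, (n + 1) * x.1 0 = m := by
    obtain ⟨hsum, hdiff⟩ := mem_latticeAdual_iff.1 x.2
    choose d hd using hdiff 0
    refine ⟨∑ i, d i, ?_⟩
    push_cast
    simp [← hd, hsum]
  choose m hm using hZ
  have hne {x y : latticeAdual n} (h : x.1 - y.1 ∈ vorS (latticeAdual n)) :
      (m x : ZMod (n + 1)) ≠ m y := by
    intro hxy
    obtain ⟨k, hk⟩ := (ZMod.intCast_eq_intCast_iff_dvd_sub _ _ _).1 hxy.symm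
    refine vorS_apply_zero_ne_int h k ?_
    have hk' : (m x - m y : ℝ) = (n + 1) * k := by exact_mod_cast hk
    rw [← hm, ← hm, ← mul_sub] at hk'
    exact mul_left_cancel₀ (by positivity) hk'
  have C : (cayleyS (latticeAdual n)).Coloring (ZMod (n + 1)) :=
    SimpleGraph.Coloring.mk (fun x => (m x : ZMod (n + 1))) fun {x y} hxy => by
      rcases ((SimpleGraph.fromRel_adj _ _ _).1 hxy).2 with h | h
      · exact hne h
      · exact (hne h).symm
  simpa [ZMod.card] using C.colorable

lemma centeredIndicator_sub {n : ℕ} {S T : Finset (Fin (n + 1))} (h : T ⊆ S) :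
    centeredIndicator S - centeredIndicator T = centeredIndicator (S \ T) := by
  ext i
  have hc : ((S \ T).card : ℝ) = S.card - T.card := by
    rw [Finset.card_sdiff_of_subset h, Nat.cast_sub (Finset.card_le_card h)]
  simp only [PiLp.sub_apply, centeredIndicator_apply, hc, Finset.mem_sdiff]
  by_cases h1 : i ∈ S <;> by_cases h2 : i ∈ T
  · simp [h1, h2]; ring
  · simp [h1, h2]; ring
  · exact absurd (h h2) h1
  · simp [h1, h2]; ring

lemma latticeAdual_le_of_colorable {n k : ℕ} (h : (cayleyS (latticeAdual n)).Colorable k) :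
    n + 1 ≤ k := by
  obtain ⟨C⟩ := h
  let p (i : Fin (n + 1)) : latticeAdual n :=
    ⟨centeredIndicator (Finset.Iio i), centeredIndicator_mem _⟩
  have hadj {i j : Fin (n + 1)} (hij : i < j) : (cayleyS (latticeAdual n)).Adj (p j) (p i) := by
    have hv : (p j).1 - (p i).1 ∈ vorS (latticeAdual n) := by
      rw [centeredIndicator_sub (Finset.Iio_subset_Iio hij.le)]
      exact centeredIndicator_mem_vorS (a := i) (b := j) (by simp [hij]) (by simp)
    refine (SimpleGraph.fromRel_adj _ _ _).2 ⟨fun he => hv.2.1 ?_, .inl hv⟩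
    rw [he, sub_self]
  have hinj : Function.Injective fun i => C (p i) := by
    intro i j hij
    rcases lt_trichotomy i j with h | h | h
    · exact absurd hij.symm (C.valid (hadj h))
    · exact h
    · exact absurd hij (C.valid (hadj h))
  simpa using Fintype.card_le_of_injective _ hinj

/-- The chromatic number of the dual root lattice `Aₙ*` is `n + 1`. -/
theorem chromatic_latticeAdual (n : ℕ) (hn : 1 ≤ n) :
    latChromS (latticeAdual n) = (n + 1 : ℕ∞) := by
  refine le_antisymm ?_ ?_
  · exact_mod_cast (latticeAdual_colorable n).chromaticNumber_le
  · refine le_iInf₂ fun k hk => ?_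
    exact_mod_cast latticeAdual_le_of_colorable hk
end
end

section
/- For n ≥ 4, define F : ℝ^n → ℝ by F(x) = 4 Σ_{1 ≤ r < s ≤ n} cos(2π x_r) cos(2π x_s), which equals the sum of cos(2π u · x) over the 2n(n−1) roots u = ±(e_r + e_s), ±(e_r − e_s) (1 ≤ r < s ≤ n) of the lattice D_n. Then the infimum of F over ℝ^n is attained and equals −2n if n is even, and −2(n−1) if n is odd. -/
open scoped Real

noncomputable section

/-- Twice the second elementary symmetric sum is the square of the sum minus the sum of squares. -/
theorem two_mul_sum_lt_mul {ι : Type*} [Fintype ι] [LinearOrder ι] (c : ι → ℝ) :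
    2 * ∑ p ∈ Finset.univ.filter (fun p : ι × ι => p.1 < p.2), c p.1 * c p.2 =
      (∑ i, c i) ^ 2 - ∑ i, c i ^ 2 := by
  have h_swap : ∑ p ∈ Finset.univ.filter (fun p : ι × ι => p.2 < p.1), c p.1 * c p.2 =
      ∑ p ∈ Finset.univ.filter (fun p : ι × ι => p.1 < p.2), c p.1 * c p.2 :=
    Finset.sum_equiv (Equiv.prodComm ι ι) (by simp) (by simp [mul_comm])
  have h_diag : ∑ i, c i ^ 2 = ∑ p : ι × ι, if p.1 = p.2 then c p.1 * c p.2 else 0 := by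
    simp [Fintype.sum_prod_type, sq]
  rw [two_mul, eq_sub_iff_add_eq, sq, Finset.sum_mul_sum, ← Fintype.sum_prod_type', h_diag]
  nth_rewrite 1 [← h_swap]
  rw [Finset.sum_filter, Finset.sum_filter, ← Finset.sum_add_distrib, ← Finset.sum_add_distrib]
  refine Finset.sum_congr rfl fun p _ => ?_
  rcases lt_trichotomy p.1 p.2 with h | h | h
  · simp [h, h.not_gt, h.ne]
  · simp [h]
  · simp [h, h.not_gt, h.ne']

/-- The function `(T + ∑ c)² - ∑ c²` is affine in each `c i`, so on the cube `[-1, 1]ˢ` it is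
bounded below by its value at some vertex; `k` is the sum of the coordinates of that vertex. -/
theorem exists_int_sq_sub_card_le {ι : Type*} (s : Finset ι) (c : ι → ℝ)
    (hc : ∀ i, |c i| ≤ 1) (T : ℝ) :
    ∃ k : ℤ, (Even k ↔ Even s.card) ∧
      (T + k) ^ 2 - s.card ≤ (T + ∑ i ∈ s, c i) ^ 2 - ∑ i ∈ s, c i ^ 2 := by
  classical
  induction s using Finset.induction_on generalizing T with
  | empty => exact ⟨0, by simp⟩
  | insert a s ha ih =>
    obtain ⟨k, hk, hle⟩ := ih (T + c a)
    obtain ⟨hl, hu⟩ := abs_le.mp (hc a)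
    rw [Finset.sum_insert ha, Finset.sum_insert ha, Finset.card_insert_of_notMem ha]
    rcases le_total 0 (T + k) with h | h
    · refine ⟨k - 1, ?_, ?_⟩
      · rw [Int.even_sub_one, Nat.even_add_one, hk]
      · push_cast
        nlinarith [mul_nonneg h (by linarith : 0 ≤ c a + 1)]
    · refine ⟨k + 1, ?_, ?_⟩
      · rw [Int.even_add_one, Nat.even_add_one, hk]
      · push_cast
        nlinarith [mul_nonneg (neg_nonneg.mpr h) (by linarith : 0 ≤ 1 - c a)]

/-- The Fourier transform of the root system of `Dₙ` (for `n ≥ 4`),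
`F(x) = 4 Σ_{r < s} cos(2π x_r) cos(2π x_s)`, which is the sum of `cos(2π u·x)` over
the `2n(n−1)` roots `±(e_r ± e_s)`, has an attained infimum over `ℝⁿ` equal to `−2n`
if `n` is even and to `−2(n−1)` if `n` is odd. -/
theorem fourier_transform_rootsystem_D {n : ℕ} (hn : 4 ≤ n)
    (F : (Fin n → ℝ) → ℝ)
    (hF : ∀ x, F x = 4 * ∑ p ∈ Finset.univ.filter (fun p : Fin n × Fin n => p.1 < p.2),
      Real.cos (2 * π * x p.1) * Real.cos (2 * π * x p.2)) :
    IsLeast (Set.range F)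
      (if Even n then -(2 * (n : ℝ)) else -(2 * ((n : ℝ) - 1))) := by
  have hG (x : Fin n → ℝ) : F x = 2 * ((∑ i, Real.cos (2 * π * x i)) ^ 2 -
      ∑ i, Real.cos (2 * π * x i) ^ 2) := by
    rw [hF, ← two_mul_sum_lt_mul fun i => Real.cos (2 * π * x i)]
    ring
  constructor
  · refine ⟨fun i => (i : ℝ) / 2, ?_⟩
    have h_cos (i : Fin n) : Real.cos (2 * π * ((i : ℝ) / 2)) = (-1) ^ (i : ℕ) := by
      rw [← Real.cos_nat_mul_pi]
      congr 1
      ring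
    have h_sq (i : ℕ) : ((-1 : ℝ) ^ i) ^ 2 = 1 := by rw [← pow_mul, mul_comm, pow_mul]; simp
    simp only [hG, h_cos, h_sq]
    rw [Fin.sum_univ_eq_sum_range (fun i => (-1 : ℝ) ^ i), neg_one_geom_sum]
    split_ifs <;> simp <;> ring
  · rintro _ ⟨x, rfl⟩
    obtain ⟨k, hk, hle⟩ := exists_int_sq_sub_card_le Finset.univ
      (fun i => Real.cos (2 * π * x i)) (fun i => Real.abs_cos_le_one _) 0
    rw [Finset.card_univ, Fintype.card_fin] at hk hle
    rw [zero_add, zero_add] at hle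
    rw [hG]
    split_ifs with h
    · nlinarith [sq_nonneg (k : ℝ)]
    · have hk0 : k ≠ 0 := by
        rintro rfl
        exact h (hk.mp (by simp))
      have hk1 : (1 : ℝ) ≤ (k : ℝ) ^ 2 := by
        exact_mod_cast Int.add_one_le_iff.mpr (sq_pos_of_ne_zero hk0)
      linarith
end
end

section
/- For every n ≥ 4, the chromatic number of the root lattice D_n = {x ∈ ℤ^n : x₁ + ⋯ + x_n is even} equals the chromatic number of the half-cube graph ½H_n, the simple graph whose vertices are the vectors x ∈ {0,1}^n with x₁ + ⋯ + x_n even, in which two distinct vertices are adjacent exactly when they differ in exactly two coordinates. That is, χ(D_n) = χ(½H_n). -/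
open scoped RealInnerProductSpace

noncomputable section

/-- The root lattice `Dₙ`: integer vectors with even coordinate sum. -/
def latticeD (n : ℕ) : Set (EuclideanSpace ℝ (Fin n)) :=
  {x | (∀ i, ∃ m : ℤ, x i = (m : ℝ)) ∧ ∃ m : ℤ, ∑ i, x i = 2 * (m : ℝ)}

/-- The half-cube graph `½Hₙ`: vertices are the 0/1-vectors of length `n` with an even
number of ones, two distinct vertices being adjacent iff they differ in exactly two
coordinates. -/
def halfCubeGraph (n : ℕ) :
    SimpleGraph {x : Fin n → Fin 2 // Even (∑ i, (x i : ℕ))} :=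
  SimpleGraph.fromRel
    (fun x y => (Finset.univ.filter (fun i => x.1 i ≠ y.1 i)).card = 2)

/-- The vector of Euclidean space with the given integer coordinates. -/
def intVec {n : ℕ} (x : Fin n → ℤ) : EuclideanSpace ℝ (Fin n) :=
  WithLp.toLp 2 fun i => (x i : ℝ)

@[simp]
lemma intVec_apply {n : ℕ} (x : Fin n → ℤ) (i : Fin n) : intVec x i = (x i : ℝ) := rfl

lemma intVec_injective {n : ℕ} : Function.Injective (intVec (n := n)) := by
  intro x y h
  funext i
  have := congrArg (fun v : EuclideanSpace ℝ (Fin n) => v i) h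
  simpa using this

lemma intVec_sub {n : ℕ} (x y : Fin n → ℤ) : intVec (x - y) = intVec x - intVec y := by
  ext i; simp

lemma intVec_add_two_smul {n : ℕ} (x y : Fin n → ℤ) :
    intVec x + (2 : ℝ) • intVec y = intVec (x + (2 : ℤ) • y) := by
  ext i; simp

lemma intVec_neg {n : ℕ} (x : Fin n → ℤ) : intVec (-x) = -intVec x := by
  ext i; simp

lemma intVec_zero {n : ℕ} : intVec (0 : Fin n → ℤ) = 0 := by
  ext i; simp

lemma norm_intVec_lt_iff {n : ℕ} (x y : Fin n → ℤ) :
    ‖intVec x‖ < ‖intVec (x + (2 : ℤ) • y)‖ ↔ 0 < ∑ i, y i * (x i + y i) := by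
  rw [← sq_lt_sq₀ (norm_nonneg _) (norm_nonneg _), EuclideanSpace.norm_sq_eq,
    EuclideanSpace.norm_sq_eq]
  simp only [intVec_apply, Real.norm_eq_abs, sq_abs]
  have h : ∑ i, (x + (2 : ℤ) • y) i ^ 2 = ∑ i, x i ^ 2 + 4 * ∑ i, y i * (x i + y i) := by
    rw [Finset.mul_sum, ← Finset.sum_add_distrib]
    refine Finset.sum_congr rfl fun i _ => ?_
    simp only [Pi.add_apply, Pi.smul_apply, smul_eq_mul]
    ring
  have h' : ∑ i, (((x + (2 : ℤ) • y) i : ℤ) : ℝ) ^ 2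
      = ∑ i, (x i : ℝ) ^ 2 + 4 * ((∑ i, y i * (x i + y i) : ℤ) : ℝ) := by
    exact_mod_cast h
  rw [h', ← Int.cast_pos (R := ℝ)]
  constructor <;> intro <;> linarith

lemma intVec_mem_latticeD {n : ℕ} (x : Fin n → ℤ) :
    intVec x ∈ latticeD n ↔ Even (∑ i, x i) := by
  rw [even_iff_exists_two_mul]
  refine ⟨fun ⟨_, m, hm⟩ => ⟨m, ?_⟩, fun ⟨m, hm⟩ => ⟨fun i => ⟨x i, rfl⟩, m, ?_⟩⟩
  · simp only [intVec_apply] at hm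
    exact_mod_cast hm
  · simp only [intVec_apply]
    exact_mod_cast hm

lemma exists_intVec_of_mem_latticeD {n : ℕ} {v : EuclideanSpace ℝ (Fin n)}
    (hv : v ∈ latticeD n) : ∃ x : Fin n → ℤ, intVec x = v := by
  choose x hx using hv.1
  exact ⟨x, by ext i; simp [hx]⟩

lemma intVec_mem_vorS_iff {n : ℕ} (x : Fin n → ℤ) :
    intVec x ∈ vorS (latticeD n) ↔ Even (∑ i, x i) ∧ x ≠ 0 ∧
      ∀ y : Fin n → ℤ, Even (∑ i, y i) → y ≠ 0 → x + y ≠ 0 →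
        0 < ∑ i, y i * (x i + y i) := by
  have h₁ (y : Fin n → ℤ) : intVec (x + (2 : ℤ) • y) = intVec x ↔ y = 0 := by
    rw [intVec_injective.eq_iff]
    simp [-zsmul_eq_mul]
  have h₂ (y : Fin n → ℤ) : intVec (x + (2 : ℤ) • y) = -intVec x ↔ x + y = 0 := by
    rw [← intVec_neg, intVec_injective.eq_iff, funext_iff, funext_iff]
    refine forall_congr' fun i => ?_
    simp only [Pi.add_apply, Pi.smul_apply, Pi.neg_apply, Pi.zero_apply, smul_eq_mul]
    omega
  have h₀ : intVec x = 0 ↔ x = 0 := by rw [← intVec_zero, intVec_injective.eq_iff]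
  simp only [vorS, Set.mem_ofPred_eq, intVec_mem_latticeD, ne_eq, h₀]
  refine and_congr_right fun _ => and_congr_right fun _ => ⟨fun h y hy hy₀ hy₁ => ?_,
    fun h v hv => ?_⟩
  · have := h (intVec y) ((intVec_mem_latticeD y).2 hy)
    rw [intVec_add_two_smul, h₁, h₂, norm_intVec_lt_iff] at this
    exact this hy₀ hy₁
  · obtain ⟨y, rfl⟩ := exists_intVec_of_mem_latticeD hv
    rw [intVec_add_two_smul, h₁, h₂, norm_intVec_lt_iff]
    exact h y ((intVec_mem_latticeD y).1 hv)

/-- Strict Voronoi vectors of `Dₙ` have exactly two odd coordinates. -/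
lemma card_odd_of_intVec_mem_vorS {n : ℕ} (hn : 2 ≤ n) {x : Fin n → ℤ}
    (h : intVec x ∈ vorS (latticeD n)) :
    (Finset.univ.filter fun i => Odd (x i)).card = 2 := by
  obtain ⟨hx, hx₀, h⟩ := (intVec_mem_vorS_iff x).1 h
  by_cases hodd : ∃ i, Odd (x i)
  · obtain ⟨i, hi⟩ := hodd
    obtain ⟨j, hji, hj⟩ : ∃ j, j ≠ i ∧ Odd (x j) := by
      by_contra! hcon
      have hrest : Even (∑ j ∈ Finset.univ.erase i, x j) :=
        Finset.even_sum _ fun j hj => Int.not_odd_iff_even.1 (hcon j (Finset.ne_of_mem_erase hj))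
      rw [← Finset.add_sum_erase _ _ (Finset.mem_univ i)] at hx
      exact Int.not_even_iff_odd.2 (hi.add_even hrest) hx
    have hzero : ∀ k, k ≠ i → k ≠ j → x k = 0 := by
      intro k hki hkj
      by_contra hk
      have hpos := h (fun k => if k = i ∨ k = j then -x k else 0) ?_ ?_ ?_
      · refine hpos.ne' (Finset.sum_eq_zero fun l _ => ?_)
        split_ifs <;> simp
      · rw [← Finset.sum_filter, Finset.filter_or, Finset.filter_eq', Finset.filter_eq']
        simp only [Finset.mem_univ, if_true]
        rw [← Finset.insert_eq, Finset.sum_pair hji.symm]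
        exact hi.neg.add_odd hj.neg
      · intro h0
        have := congrFun h0 i
        simp only [true_or, if_true, Pi.zero_apply, neg_eq_zero] at this
        simp [this] at hi
      · intro h0
        have := congrFun h0 k
        simp [hki, hkj, hk] at this
    have : (Finset.univ.filter fun i => Odd (x i)) = {i, j} := by
      ext k
      simp only [Finset.mem_filter, Finset.mem_univ, true_and, Finset.mem_insert,
        Finset.mem_singleton]
      refine ⟨fun hk => ?_, by rintro (rfl | rfl) <;> assumption⟩
      by_contra! hcon
      simp [hzero k hcon.1 hcon.2] at hk
    rw [this, Finset.card_pair hji.symm]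
  · simp only [not_exists, Int.not_odd_iff_even] at hodd
    exfalso
    obtain ⟨i, hi⟩ := Function.ne_iff.1 hx₀
    rw [Pi.zero_apply] at hi
    have hzero : ∀ k, k ≠ i → x k = 0 := by
      intro k hki
      by_contra hk
      have hpos := h (fun k => if k = i then -x k else 0) ?_ ?_ ?_
      · refine hpos.ne' (Finset.sum_eq_zero fun l _ => ?_)
        split_ifs <;> simp
      · simpa using hodd i
      · intro h0
        have := congrFun h0 i
        simp [hi] at this
      · intro h0
        have := congrFun h0 k
        simp [hki, hk] at this
    have : Nontrivial (Fin n) := Fin.nontrivial_iff_two_le.2 hn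
    obtain ⟨j, hji⟩ := exists_ne i
    obtain ⟨s, hs, hsx⟩ : ∃ s : ℤ, (s = 1 ∨ s = -1) ∧ 2 ≤ s * x i := by
      obtain ⟨m, hm⟩ := hodd i
      rcases lt_or_gt_of_ne hi with hlt | hgt
      · exact ⟨-1, Or.inr rfl, by omega⟩
      · exact ⟨1, Or.inl rfl, by omega⟩
    have hpos := h (fun k => if k = i then -s else if k = j then 1 else 0) ?_ ?_ ?_
    · rw [← Finset.add_sum_erase _ _ (Finset.mem_univ i),
        ← Finset.add_sum_erase _ _ (Finset.mem_erase.2 ⟨hji, Finset.mem_univ j⟩),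
        Finset.sum_eq_zero] at hpos
      · simp only [if_true, hji, if_false, hzero j hji] at hpos
        rcases hs with rfl | rfl <;> omega
      · intro k hk
        simp only [Finset.mem_erase] at hk
        simp [hk.1, hk.2.1]
    · rw [← Finset.add_sum_erase _ _ (Finset.mem_univ i),
        ← Finset.add_sum_erase _ _ (Finset.mem_erase.2 ⟨hji, Finset.mem_univ j⟩),
        Finset.sum_eq_zero]
      · simp only [if_true, hji, if_false]
        rcases hs with rfl | rfl <;> decide
      · intro k hk
        simp only [Finset.mem_erase] at hk
        simp [hk.1, hk.2.1]
    · intro h0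
      have := congrFun h0 j
      simp [hji] at this
    · intro h0
      have := congrFun h0 j
      simp [hji, hzero j hji] at this

/-- The roots of `Dₙ` are strict Voronoi vectors. -/
lemma intVec_mem_vorS_of_card {n : ℕ} {x : Fin n → ℤ}
    (hx : ∀ i, x i = -1 ∨ x i = 0 ∨ x i = 1)
    (hcard : (Finset.univ.filter fun i => x i ≠ 0).card = 2) :
    intVec x ∈ vorS (latticeD n) := by
  obtain ⟨i, j, hij, hS⟩ := Finset.card_eq_two.1 hcard
  have hne (k : Fin n) : x k ≠ 0 ↔ k = i ∨ k = j := by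
    have := congrArg (fun S => k ∈ S) hS
    simpa using this
  have hsum (y : Fin n → ℤ) (hy : ∀ k, k ≠ i → k ≠ j → y k = 0) : ∑ k, y k = y i + y j := by
    rw [← Finset.sum_pair hij]
    refine (Finset.sum_subset (Finset.subset_univ _) fun k _ hk => ?_).symm
    simp only [Finset.mem_insert, Finset.mem_singleton, not_or] at hk
    exact hy k hk.1 hk.2
  have hx₀ (k : Fin n) (hki : k ≠ i) (hkj : k ≠ j) : x k = 0 := by
    by_contra hk
    exact ((hne k).1 hk).elim hki hkj
  have hi := (hne i).2 (Or.inl rfl)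
  have hj := (hne j).2 (Or.inr rfl)
  refine (intVec_mem_vorS_iff x).2 ⟨?_, fun h => hi (congrFun h i), fun y hy hy₀ hy₁ => ?_⟩
  · rw [hsum x hx₀, Int.even_iff]
    have := hx i
    have := hx j
    omega
  · have hnonneg : ∀ k ∈ Finset.univ, 0 ≤ y k * (x k + y k) := by
      intro k _
      rcases lt_trichotomy (y k) 0 with h | h | h
      · exact mul_nonneg_of_nonpos_of_nonpos h.le (by have := hx k; omega)
      · simp [h]
      · exact mul_nonneg h.le (by have := hx k; omega)
    refine lt_of_le_of_ne (Finset.sum_nonneg hnonneg) fun hzero => ?_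
    have hterm (k : Fin n) : y k = 0 ∨ x k + y k = 0 :=
      mul_eq_zero.1 ((Finset.sum_eq_zero_iff_of_nonneg hnonneg).1 hzero.symm k (Finset.mem_univ k))
    have hy_rest (k : Fin n) (hki : k ≠ i) (hkj : k ≠ j) : y k = 0 := by
      have := hterm k
      have := hx₀ k hki hkj
      omega
    rw [hsum y hy_rest, Int.even_iff] at hy
    have hxi := hx i
    have hxj := hx j
    have hyi := hterm i
    have hyj := hterm j
    by_cases hyi₀ : y i = 0
    · refine hy₀ (funext fun k => ?_)
      by_cases hki : k = i
      · rw [hki]; exact hyi₀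
      by_cases hkj : k = j
      · rw [hkj, Pi.zero_apply]; omega
      exact hy_rest k hki hkj
    · refine hy₁ (funext fun k => ?_)
      rw [Pi.add_apply, Pi.zero_apply]
      by_cases hki : k = i
      · rw [hki]; omega
      by_cases hkj : k = j
      · rw [hkj]; omega
      rw [hx₀ k hki hkj, hy_rest k hki hkj, add_zero]

/-- The inclusion of the half-cube graph into the Cayley graph of `Dₙ`. -/
def halfCubeToLatticeD (n : ℕ) : halfCubeGraph n →g cayleyS (latticeD n) where
  toFun x := ⟨intVec fun i => ((x.1 i : ℕ) : ℤ), by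
    rw [intVec_mem_latticeD]
    exact_mod_cast (Int.even_coe_nat _).2 x.2⟩
  map_rel' := by
    have key (x y : Fin n → Fin 2)
        (h : (Finset.univ.filter fun i => x i ≠ y i).card = 2) :
        intVec (fun i => ((x i : ℕ) : ℤ)) - intVec (fun i => ((y i : ℕ) : ℤ))
          ∈ vorS (latticeD n) := by
      rw [← intVec_sub]
      refine intVec_mem_vorS_of_card (fun i => ?_) ?_
      · simp only [Pi.sub_apply]
        omega
      · refine Eq.trans ?_ h
        congr 1
        ext i
        simp only [Pi.sub_apply, Finset.mem_filter, Finset.mem_univ, true_and]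
        omega
    intro x y hxy
    rw [halfCubeGraph, SimpleGraph.fromRel_adj] at hxy
    rw [cayleyS, SimpleGraph.fromRel_adj]
    refine ⟨fun h => hxy.1 (Subtype.ext (funext fun i => ?_)),
      hxy.2.imp (key x.1 y.1) (key y.1 x.1)⟩
    have := congrFun (intVec_injective (congrArg Subtype.val h)) i
    omega

/-- Reduction modulo two as a map from the Cayley graph of `Dₙ` to the half-cube graph. -/
lemma nonempty_latticeD_hom_halfCube {n : ℕ} (hn : 2 ≤ n) :
    Nonempty (cayleyS (latticeD n) →g halfCubeGraph n) := by
  have hlift (v : latticeD n) : ∃ x : Fin n → ℤ, intVec x = v.1 :=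
    exists_intVec_of_mem_latticeD v.2
  choose c hc using hlift
  let r : (Fin n → ℤ) → Fin n → Fin 2 := fun x i => if Odd (x i) then 1 else 0
  have hr (x : Fin n → ℤ) (hx : Even (∑ i, x i)) : Even (∑ i, (r x i : ℕ)) := by
    rw [← Int.even_coe_nat, Nat.cast_sum]
    have : Even (∑ i, (x i - ((r x i : ℕ) : ℤ))) := by
      refine Finset.even_sum _ fun i _ => ?_
      by_cases h : Odd (x i)
      · simp [r, h, h.sub_odd odd_one]
      · simp [r, h, Int.not_odd_iff_even.1 h]
    rw [Finset.sum_sub_distrib, Int.even_sub] at this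
    exact this.1 hx
  have key (v w : latticeD n) (h : v.1 - w.1 ∈ vorS (latticeD n)) :
      (Finset.univ.filter fun i => r (c v) i ≠ r (c w) i).card = 2 := by
    rw [← hc v, ← hc w, ← intVec_sub] at h
    refine Eq.trans ?_ (card_odd_of_intVec_mem_vorS hn h)
    congr 1
    ext i
    simp only [Finset.mem_filter, Finset.mem_univ, true_and, Pi.sub_apply, Int.odd_sub,
      ← Int.not_odd_iff_even, r]
    by_cases h₁ : Odd (c v i) <;> by_cases h₂ : Odd (c w i) <;> simp [h₁, h₂]
  refine ⟨⟨fun v => ⟨r (c v), hr _ ?_⟩, fun {v w} hvw => ?_⟩⟩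
  · rw [← intVec_mem_latticeD, hc]
    exact v.2
  · rw [cayleyS, SimpleGraph.fromRel_adj] at hvw
    rw [halfCubeGraph, SimpleGraph.fromRel_adj]
    have hor := hvw.2.imp (key v w) (key w v)
    refine ⟨fun h => ?_, hor⟩
    have heq : r (c v) = r (c w) := congrArg Subtype.val h
    simp [heq] at hor

/-- For `n ≥ 4`, the chromatic number of the root lattice `Dₙ` equals the chromatic
number of the half-cube graph `½Hₙ`. -/
theorem chromatic_latticeD_eq_halfCube (n : ℕ) (hn : 4 ≤ n) :
    latChromS (latticeD n) = (halfCubeGraph n).chromaticNumber := by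
  obtain ⟨f⟩ := nonempty_latticeD_hom_halfCube (n := n) (by omega)
  exact le_antisymm (SimpleGraph.chromaticNumber_mono_of_hom f)
    (SimpleGraph.chromaticNumber_mono_of_hom (halfCubeToLatticeD n))
end
end

section
/- For every n ≥ 4, the lattice D_n* = ℤ^n ∪ ((1/2, …, 1/2) + ℤ^n) ⊆ ℝ^n has chromatic number χ(D_n*) = 4. -/
open scoped RealInnerProductSpace

noncomputable section

/-- The lattice `Dₙ* = ℤⁿ ∪ ((1/2, …, 1/2) + ℤⁿ)`. -/
def latticeDdual (n : ℕ) : Set (EuclideanSpace ℝ (Fin n)) :=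
  {x | (∀ i, ∃ m : ℤ, x i = (m : ℝ)) ∨ (∀ i, ∃ m : ℤ, x i = (m : ℝ) + 1 / 2)}

section LatticeDdual

variable {n : ℕ}

theorem EuclideanSpace.norm_lt_norm_of_sq_le {u w : EuclideanSpace ℝ (Fin n)}
    (hle : ∀ i, u i ^ 2 ≤ w i ^ 2) (hlt : ∃ i, u i ^ 2 < w i ^ 2) : ‖u‖ < ‖w‖ := by
  refine lt_of_pow_lt_pow_left₀ 2 (norm_nonneg _) ?_
  rw [EuclideanSpace.real_norm_sq_eq, EuclideanSpace.real_norm_sq_eq]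
  obtain ⟨i, hi⟩ := hlt
  exact Finset.sum_lt_sum (fun j _ => hle j) ⟨i, Finset.mem_univ i, hi⟩

theorem sq_le_sq_half_add_even {a : ℝ} (ha : a = 1 / 2 ∨ a = -(1 / 2)) (m : ℤ) :
    a ^ 2 ≤ (a + 2 * m) ^ 2 ∧ (a + 2 * m ≠ a → a ^ 2 < (a + 2 * m) ^ 2) := by
  rcases lt_trichotomy m 0 with hm | rfl | hm
  · have : (m : ℝ) ≤ -1 := by exact_mod_cast Int.le_sub_one_of_lt hm
    have : a ^ 2 < (a + 2 * m) ^ 2 := by rcases ha with rfl | rfl <;> nlinarith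
    exact ⟨this.le, fun _ => this⟩
  · simp
  · have : (1 : ℝ) ≤ m := by exact_mod_cast hm
    have : a ^ 2 < (a + 2 * m) ^ 2 := by rcases ha with rfl | rfl <;> nlinarith
    exact ⟨this.le, fun _ => this⟩

theorem half_mem_vorS_latticeDdual (hn : 0 < n) {u : EuclideanSpace ℝ (Fin n)}
    (hu : ∀ i, u i = 1 / 2 ∨ u i = -(1 / 2)) : u ∈ vorS (latticeDdual n) := by
  refine ⟨Or.inr fun i => ?_, ?_, ?_⟩
  · rcases hu i with h | h
    · exact ⟨0, by rw [h]; norm_num⟩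
    · exact ⟨-1, by rw [h]; norm_num⟩
  · rintro rfl
    have := hu ⟨0, hn⟩
    norm_num at this
  · rintro v (hv | hv) h1 h2 <;> choose m hm using hv
    · have key (i : Fin n) := sq_le_sq_half_add_even (hu i) (m i)
      refine EuclideanSpace.norm_lt_norm_of_sq_le (fun i => ?_) ?_
      · simpa [hm i] using (key i).1
      · by_contra! hcon
        refine h1 (PiLp.ext fun i => ?_)
        by_contra hne
        have hc := hcon i
        simp only [PiLp.add_apply, PiLp.smul_apply, smul_eq_mul, hm i] at hne hc
        exact absurd ((key i).2 hne) (not_lt.2 hc)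
    · have hu' (i : Fin n) : -u i = 1 / 2 ∨ -u i = -(1 / 2) := by
        rcases hu i with h | h <;> rw [h] <;> norm_num
      have shift (i : Fin n) : ∃ k : ℤ, u i + 2 * v i = -u i + 2 * k := by
        rcases hu i with h | h
        · exact ⟨m i + 1, by rw [h, hm i]; push_cast; ring⟩
        · exact ⟨m i, by rw [h, hm i]; ring⟩
      choose k hk using shift
      have key (i : Fin n) := sq_le_sq_half_add_even (hu' i) (k i)
      refine EuclideanSpace.norm_lt_norm_of_sq_le (fun i => ?_) ?_
      · simpa [hk i] using (key i).1
      · by_contra! hcon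
        refine h2 (PiLp.ext fun i => ?_)
        by_contra hne
        have hc := hcon i
        simp only [PiLp.add_apply, PiLp.smul_apply, PiLp.neg_apply, smul_eq_mul, hk i] at hne hc
        have := (key i).2 hne
        rw [neg_sq] at this
        exact absurd this (not_lt.2 hc)

theorem single_mem_vorS_latticeDdual (hn : 3 ≤ n) (i : Fin n) :
    EuclideanSpace.single i (1 : ℝ) ∈ vorS (latticeDdual n) := by
  refine ⟨Or.inl fun j => ⟨if j = i then 1 else 0, by simp⟩, by simp, ?_⟩
  rintro v (hv | hv) h1 h2 <;> choose m hm using hv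
  · have hle (j : Fin n) : (EuclideanSpace.single i (1 : ℝ)) j ^ 2 ≤
        (EuclideanSpace.single i (1 : ℝ) + (2 : ℝ) • v) j ^ 2 := by
      by_cases hj : j = i
      · subst hj
        have : (1 : ℤ) ≤ (1 + 2 * m j) ^ 2 := by
          have : 1 + 2 * m j ≠ 0 := by omega
          have := sq_pos_of_ne_zero this
          omega
        have : (1 : ℝ) ≤ (1 + 2 * m j) ^ 2 := by exact_mod_cast this
        simpa [hm j] using this
      · simp [hj]; positivity
    refine EuclideanSpace.norm_lt_norm_of_sq_le hle ?_
    by_contra! hcon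
    have heq j := le_antisymm (hle j) (hcon j)
    have hoff (j : Fin n) (hj : j ≠ i) : v j = 0 := by simpa [hj] using (heq j).symm
    rcases sq_eq_sq_iff_eq_or_eq_neg.1 (heq i) with h | h
    · refine h1 (PiLp.ext fun j => ?_)
      by_cases hj : j = i
      · rw [hj, h]
      · simp [hj, hoff j hj]
    · refine h2 (PiLp.ext fun j => ?_)
      by_cases hj : j = i
      · rw [hj, PiLp.neg_apply, h, neg_neg]
      · simp [hj, hoff j hj]
  · have hcard : ∃ j k : Fin n, j ≠ i ∧ k ≠ i ∧ k ≠ j := by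
      obtain ⟨j, hj⟩ := Finset.exists_mem_notMem_of_card_lt_card
        (s := {i}) (t := (Finset.univ : Finset (Fin n))) (by simp; omega)
      obtain ⟨k, hk⟩ := Finset.exists_mem_notMem_of_card_lt_card
        (s := {i, j}) (t := (Finset.univ : Finset (Fin n)))
        (lt_of_le_of_lt Finset.card_le_two (by simp; omega))
      simp at hj hk
      exact ⟨j, k, hj, hk⟩
    obtain ⟨j, k, hj, hk, hkj⟩ := hcard
    have hodd (l : Fin n) (hl : l ≠ i) :
        (1 : ℝ) ≤ (EuclideanSpace.single i (1 : ℝ) + (2 : ℝ) • v) l ^ 2 := by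
      have : (1 : ℤ) ≤ (2 * m l + 1) ^ 2 := by
        have : 2 * m l + 1 ≠ 0 := by omega
        have := sq_pos_of_ne_zero this
        omega
      have : (1 : ℝ) ≤ (2 * m l + 1) ^ 2 := by exact_mod_cast this
      simpa [hl, hm l, mul_add] using this
    have hnorm : ‖EuclideanSpace.single i (1 : ℝ)‖ = ‖EuclideanSpace.single j (1 : ℝ)‖ := by simp
    rw [hnorm]
    refine EuclideanSpace.norm_lt_norm_of_sq_le (fun l => ?_) ⟨k, ?_⟩
    · by_cases hl : l = j
      · subst hl
        simpa using hodd l hj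
      · have : (EuclideanSpace.single j (1 : ℝ)) l = 0 := by simp [hl]
        rw [this, zero_pow two_ne_zero]
        exact sq_nonneg _
    · have : (EuclideanSpace.single j (1 : ℝ)) k = 0 := by simp [hkj]
      rw [this]
      linarith [hodd k hk]

theorem odd_sum_of_mem_vorS_latticeDdual {u : EuclideanSpace ℝ (Fin n)}
    (hu : u ∈ vorS (latticeDdual n)) {m : Fin n → ℤ} (hm : ∀ i, u i = m i) :
    Odd (∑ i, m i) := by
  obtain ⟨-, h0, hmin⟩ := hu
  obtain ⟨i, hi⟩ : ∃ i, m i ≠ 0 := by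
    by_contra! h
    exact h0 (PiLp.ext fun i => by simp [hm i, h i])
  have hoff (j : Fin n) (hj : j ≠ i) : m j = 0 := by
    by_contra hmj
    refine absurd (hmin (EuclideanSpace.single i (-(m i : ℝ))) ?_ ?_ ?_) (not_lt.2 (le_of_eq ?_))
    · exact Or.inl fun l => ⟨if l = i then -m i else 0, by
        by_cases hl : l = i <;> simp [hl]⟩
    · intro h
      have := congrArg (fun x => x i) h
      simp at this
      exact hi this
    · intro h
      have := congrArg (fun x => x j) h
      simp [hj, hm j] at this
      have : (m j : ℝ) = 0 := by linarith
      exact hmj (by exact_mod_cast this)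
    · refine (sq_eq_sq₀ (norm_nonneg _) (norm_nonneg _)).1 ?_
      rw [EuclideanSpace.real_norm_sq_eq, EuclideanSpace.real_norm_sq_eq]
      refine Finset.sum_congr rfl fun l _ => ?_
      by_cases hl : l = i
      · subst hl
        simp [hm l]; ring
      · simp [hl]
  rw [Finset.sum_eq_single i (fun j _ hj => hoff j hj) (by simp)]
  by_contra hodd
  obtain ⟨k, hk⟩ := Int.not_odd_iff_even.1 hodd
  have hzero : u + (2 : ℝ) • EuclideanSpace.single i (-(k : ℝ)) = 0 := by
    refine PiLp.ext fun j => ?_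
    by_cases hj : j = i
    · subst hj
      simp [hm j, hk]; ring
    · simp [hj, hm j, hoff j hj]
  have := hmin (EuclideanSpace.single i (-(k : ℝ))) (Or.inl fun l => ⟨if l = i then -k else 0, by
    by_cases hl : l = i <;> simp [hl]⟩) (by rw [hzero]; exact h0.symm)
    (by rw [hzero]; exact (neg_ne_zero.2 h0).symm)
  rw [hzero, norm_zero] at this
  exact absurd this (not_lt.2 (norm_nonneg _))

open Classical in
/-- The translate of `ℤⁿ` containing the point, together with the parity of the sum of the
integer parts of its coordinates. -/
def parityColor (x : latticeDdual n) : Bool × Bool :=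
  (decide (∀ i, ∃ m : ℤ, x.1 i = m), decide (Even (∑ i, ⌊x.1 i⌋)))

theorem parityColor_ne {x y : latticeDdual n} (h : (x.1 - y.1) ∈ vorS (latticeDdual n)) :
    parityColor x ≠ parityColor y := by
  intro heq
  simp only [parityColor, Prod.mk.injEq, decide_eq_decide] at heq
  obtain ⟨htype, hpar⟩ := heq
  have hdiff (i : Fin n) : (x.1 - y.1) i = ((⌊x.1 i⌋ - ⌊y.1 i⌋ : ℤ) : ℝ) := by
    by_cases hx : ∀ i, ∃ m : ℤ, x.1 i = m
    · obtain ⟨a, ha⟩ := hx i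
      obtain ⟨b, hb⟩ := htype.1 hx i
      simp [ha, hb]
    · obtain ⟨a, ha⟩ := x.2.resolve_left hx i
      obtain ⟨b, hb⟩ := y.2.resolve_left (fun hy => hx (htype.2 hy)) i
      have hfl (c : ℤ) : ⌊(c : ℝ) + 1 / 2⌋ = c := by
        rw [Int.floor_intCast_add]; norm_num
      rw [PiLp.sub_apply, ha, hb, hfl, hfl]
      push_cast
      ring
  have hodd := odd_sum_of_mem_vorS_latticeDdual h hdiff
  rw [Finset.sum_sub_distrib, Int.odd_sub'] at hodd
  rw [← Int.not_even_iff_odd] at hodd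
  tauto

theorem cayleyS_latticeDdual_colorable : (cayleyS (latticeDdual n)).Colorable 4 := by
  refine (SimpleGraph.Coloring.mk parityColor ?_).colorable
  rintro x y ⟨-, h | h⟩
  · exact parityColor_ne h
  · exact (parityColor_ne h).symm

theorem latticeDdual_cayleyS_adj {x y : latticeDdual n}
    (h : (x.1 - y.1) ∈ vorS (latticeDdual n)) : (cayleyS (latticeDdual n)).Adj x y := by
  refine ⟨?_, Or.inl h⟩
  rintro rfl
  exact h.2.1 (sub_self _)

theorem four_le_chromaticNumber_cayleyS_latticeDdual (hn : 3 ≤ n) :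
    4 ≤ (cayleyS (latticeDdual n)).chromaticNumber := by
  have hpos : 0 < n := by omega
  let i : Fin n := ⟨0, by omega⟩
  let j : Fin n := ⟨1, by omega⟩
  have hij : i ≠ j := by simp [i, j]
  let h : EuclideanSpace ℝ (Fin n) := WithLp.toLp 2 fun _ => 1 / 2
  let a : latticeDdual n := ⟨0, Or.inl fun _ => ⟨0, by simp⟩⟩
  let b : latticeDdual n := ⟨EuclideanSpace.single j 1,
    Or.inl fun l => ⟨if l = j then 1 else 0, by simp⟩⟩
  let c : latticeDdual n := ⟨h, Or.inr fun _ => ⟨0, by simp [h]⟩⟩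
  let d : latticeDdual n := ⟨h - EuclideanSpace.single i 1,
    Or.inr fun l => ⟨if l = i then -1 else 0, by by_cases hl : l = i <;> simp [h, hl] <;> ring⟩⟩
  have hba : (cayleyS (latticeDdual n)).Adj b a := latticeDdual_cayleyS_adj <| by
    simpa [a, b] using single_mem_vorS_latticeDdual hn j
  have hcd : (cayleyS (latticeDdual n)).Adj c d := latticeDdual_cayleyS_adj <| by
    simpa [c, d] using single_mem_vorS_latticeDdual hn i
  have hca : (cayleyS (latticeDdual n)).Adj c a := latticeDdual_cayleyS_adj <|
    half_mem_vorS_latticeDdual hpos fun l => by simp [a, c, h]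
  have hda : (cayleyS (latticeDdual n)).Adj d a := latticeDdual_cayleyS_adj <|
    half_mem_vorS_latticeDdual hpos fun l => by
      by_cases hl : l = i <;> simp [a, d, h, hl] <;> norm_num
  have hcb : (cayleyS (latticeDdual n)).Adj c b := latticeDdual_cayleyS_adj <|
    half_mem_vorS_latticeDdual hpos fun l => by
      by_cases hl : l = j <;> simp [b, c, h, hl] <;> norm_num
  have hdb : (cayleyS (latticeDdual n)).Adj d b := latticeDdual_cayleyS_adj <|
    half_mem_vorS_latticeDdual hpos fun l => by
      by_cases hl : l = i
      · simp [b, d, h, hl, hij]; norm_num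
      · by_cases hl' : l = j <;> simp [b, d, h, hl, hl', hij.symm] <;> norm_num
  classical
  have hclique : (cayleyS (latticeDdual n)).IsNClique 4 {d, c, b, a} :=
    (SimpleGraph.is3Clique_triple_iff.2 ⟨hcb, hca, hba⟩).insert (by
      simp [hcd.symm, hdb, hda])
  have := hclique.1.card_le_chromaticNumber
  rwa [hclique.2] at this

end LatticeDdual

/-- For every `n ≥ 4`, the chromatic number of `Dₙ*` is `4`. -/
theorem chromatic_latticeDdual (n : ℕ) (hn : 4 ≤ n) :
    latChromS (latticeDdual n) = 4 := by
  exact le_antisymm cayleyS_latticeDdual_colorable.chromaticNumber_le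
    (four_le_chromaticNumber_cayleyS_latticeDdual (by omega))
end
end
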